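/- There exists a left-linear TRS R (over a signature with a binary AC symbol +) that is terminating (but not AC-terminating), such that all prime critical pairs of R and all prime critical pairs between R and AC^± are joinable modulo AC, yet R is not Church–Rosser modulo AC. -/

import Mathlib

/-- First-order terms over a signature `F` with natural-number variables. -/
inductive Tm (F : Type) : Type
  | var : Nat → Tm F
  | fn  : F → List (Tm F) → Tm F

namespace Tm

variable {F : Type}

mutual
def subst (σ : Nat → Tm F) : Tm F → Tm F
  | .var n => σ n
  | .fn f ts => .fn f (substList σ ts)
def substList (σ : Nat → Tm F) : List (Tm F) → List (Tm F)
  | [] => []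
  | t :: ts => subst σ t :: substList σ ts
end

mutual
def varsList : Tm F → List Nat
  | .var n => [n]
  | .fn _ ts => varsListL ts
def varsListL : List (Tm F) → List Nat
  | [] => []
  | t :: ts => varsList t ++ varsListL ts
end

/-- The set of variables of a term. -/
def vars (t : Tm F) : Set Nat := {n | n ∈ varsList t}

/-- A term is linear if no variable occurs more than once. -/
def Linear (t : Tm F) : Prop := (varsList t).Nodup

/-- The subterm at a given position (if the position exists). -/
def subtermAt : Tm F → List Nat → Option (Tm F)
  | t, [] => some t
  | .var _, _ :: _ => none
  | .fn _ ts, i :: p =>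
    match ts[i]? with
    | some u => subtermAt u p
    | none => none
  termination_by t p => p.length

/-- Replacement of the subterm at a given position. -/
def replaceAt : Tm F → List Nat → Tm F → Option (Tm F)
  | _, [], s => some s
  | .var _, _ :: _, _ => none
  | .fn f ts, i :: p, s =>
    match ts[i]? with
    | some u => (replaceAt u p s).map fun u' => .fn f (ts.set i u')
    | none => none
  termination_by t p _ => p.length

end Tm

open Tm

/-- A term rewrite system (or equational system): a set of pairs of terms. -/
abbrev TRS (F : Type) := Set (Tm F × Tm F)

/-- Well-formedness of the rules: left-hand sides are not variables and
variables of right-hand sides occur on the left. -/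
def IsTRS {F : Type} (R : TRS F) : Prop :=
  ∀ p ∈ R, (∀ n, p.1 ≠ .var n) ∧ vars p.2 ⊆ vars p.1

def LeftLinear {F : Type} (R : TRS F) : Prop := ∀ p ∈ R, Linear p.1

/-- One-step rewrite relation of a set of rules (closed under contexts and
substitutions). -/
def Rew {F : Type} (R : TRS F) (s t : Tm F) : Prop :=
  ∃ p l r σ, (l, r) ∈ R ∧ subtermAt s p = some (subst σ l) ∧
    replaceAt s p (subst σ r) = some t

/-- Normal forms. -/
def NF {A : Type} (r : A → A → Prop) (a : A) : Prop := ∀ b, ¬ r a b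

/-- The equational theory `∼B` generated by an ES `B`. -/
def simE {F : Type} (B : TRS F) : Tm F → Tm F → Prop :=
  Relation.EqvGen (Rew B)

/-- Rewriting modulo: `∼B · →R · ∼B`. -/
def RewMod {F : Type} (R B : TRS F) (s t : Tm F) : Prop :=
  ∃ s' t', simE B s s' ∧ Rew R s' t' ∧ simE B t' t

def Terminating {F : Type} (R : TRS F) : Prop :=
  WellFounded (fun a b => Rew R b a)

def TerminatingMod {F : Type} (R B : TRS F) : Prop :=
  WellFounded (fun a b => RewMod R B b a)

/-- Conversion modulo `B`: arbitrary sequences of `→R`, `←R` and `∼B` steps. -/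
def ConvMod {F : Type} (R B : TRS F) : Tm F → Tm F → Prop :=
  Relation.ReflTransGen (fun a b => Rew R a b ∨ Rew R b a ∨ simE B a b)

/-- Joinability modulo `B` using the plain rewrite relation:
`→R* · ∼B · ←R*`. -/
def JoinMod {F : Type} (R B : TRS F) (s t : Tm F) : Prop :=
  ∃ u v, Relation.ReflTransGen (Rew R) s u ∧ simE B u v ∧
    Relation.ReflTransGen (Rew R) t v

def ChurchRosserMod {F : Type} (R B : TRS F) : Prop :=
  ∀ s t, ConvMod R B s t → JoinMod R B s t

def Joinable {F : Type} (R : TRS F) (s t : Tm F) : Prop :=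
  ∃ v, Relation.ReflTransGen (Rew R) s v ∧ Relation.ReflTransGen (Rew R) t v

def Confluent {F : Type} (R : TRS F) : Prop :=
  ∀ s t u, Relation.ReflTransGen (Rew R) s t → Relation.ReflTransGen (Rew R) s u →
    Joinable R t u

/-- Renaming a term by a bijection on variables. -/
def rename {F : Type} (ρ : Nat ≃ Nat) (t : Tm F) : Tm F :=
  subst (fun n => .var (ρ n)) t

def VariantTm {F : Type} (s t : Tm F) : Prop := ∃ ρ : Nat ≃ Nat, rename ρ s = t

def VariantRule {F : Type} (p q : Tm F × Tm F) : Prop :=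
  ∃ ρ : Nat ≃ Nat, rename ρ p.1 = q.1 ∧ rename ρ p.2 = q.2

def Unifies {F : Type} (σ : Nat → Tm F) (s t : Tm F) : Prop := subst σ s = subst σ t

/-- Most general unifier. -/
def IsMGU {F : Type} (σ : Nat → Tm F) (s t : Tm F) : Prop :=
  Unifies σ s t ∧ ∀ τ, Unifies τ s t → ∃ δ, ∀ n, τ n = subst δ (σ n)

/-- `CriticalPeak R₁ R₂ t p s u` : `t ←R₁[p] s →R₂[ε] u` is a critical peak
obtained from an overlap of variable-disjoint variants of rules of `R₁`
(inner rule) and `R₂` (root rule). -/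
def CriticalPeak {F : Type} (R₁ R₂ : TRS F) (t : Tm F) (p : List Nat) (s u : Tm F) :
    Prop :=
  ∃ l₁ r₁ l₂ r₂ σ,
    (∃ q ∈ R₁, VariantRule q (l₁, r₁)) ∧
    (∃ q ∈ R₂, VariantRule q (l₂, r₂)) ∧
    (vars l₁ ∪ vars r₁) ∩ (vars l₂ ∪ vars r₂) = ∅ ∧
    (∃ f ts, subtermAt l₂ p = some (.fn f ts) ∧ IsMGU σ l₁ (.fn f ts)) ∧
    (p = [] → ¬ VariantRule (l₁, r₁) (l₂, r₂)) ∧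
    s = subst σ l₂ ∧
    replaceAt s p (subst σ r₁) = some t ∧
    u = subst σ r₂

/-- The set of critical pairs between `R₁` and `R₂`. -/
def CP {F : Type} (R₁ R₂ : TRS F) : Set (Tm F × Tm F) :=
  {tu | ∃ p s, CriticalPeak R₁ R₂ tu.1 p s tu.2}

/-- A critical peak `t ←[p] s →[ε] u` is prime (w.r.t. `R`) if all proper
subterms of `s|p` are in normal form w.r.t. `→R`. -/
def PrimeAt {F : Type} (R : TRS F) (s : Tm F) (p : List Nat) : Prop :=
  ∀ q v, q ≠ [] → subtermAt s (p ++ q) = some v → NF (Rew R) v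

/-- Prime critical pairs of a TRS. -/
def PCP {F : Type} (R : TRS F) : Set (Tm F × Tm F) :=
  {tu | ∃ p s, CriticalPeak R R tu.1 p s tu.2 ∧ PrimeAt R s p}

/-- `E ∪ E⁻¹`. -/
def sympm {F : Type} (E : TRS F) : TRS F :=
  E ∪ {q | ∃ p ∈ E, q = (p.2, p.1)}

/-- Prime critical pairs between `R` and `B^±` (in both directions), where
primality is always checked with respect to `→R`. -/
def PCPpm {F : Type} (R B : TRS F) : Set (Tm F × Tm F) :=
  {tu | ∃ p s, (CriticalPeak R (sympm B) tu.1 p s tu.2 ∨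
                CriticalPeak (sympm B) R tu.1 p s tu.2) ∧ PrimeAt R s p}

/-- The associativity and commutativity axioms for the symbols in `Ac`,
oriented left-to-right. -/
def ACax {F : Type} (Ac : Set F) : TRS F :=
  {q | ∃ f ∈ Ac,
    q = (Tm.fn f [Tm.fn f [Tm.var 0, Tm.var 1], Tm.var 2],
         Tm.fn f [Tm.var 0, Tm.fn f [Tm.var 1, Tm.var 2]]) ∨
    q = (Tm.fn f [Tm.var 0, Tm.var 1], Tm.fn f [Tm.var 1, Tm.var 0])}

/-- AC equivalence of terms. -/
def simAC {F : Type} (Ac : Set F) : Tm F → Tm F → Prop := simE (ACax Ac)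

/-- Peterson–Stickel rewriting: rewriting with AC matching at the redex. -/
def RewPS {F : Type} (Ac : Set F) (R : TRS F) (s t : Tm F) : Prop :=
  ∃ p l r σ w, (l, r) ∈ R ∧ subtermAt s p = some w ∧ simAC Ac w (subst σ l) ∧
    replaceAt s p (subst σ r) = some t

/-- The extended system `R^e`: `R` together with all extensions
`f(f(u,v),x) → f(r,x)` of rules `f(u,v) → r` with `f` an AC symbol
and `x` a fresh variable. -/
def ACExt {F : Type} (Ac : Set F) (R : TRS F) : TRS F :=
  R ∪ {q | ∃ f ∈ Ac, ∃ u v r x, (Tm.fn f [u, v], r) ∈ R ∧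
        x ∉ vars (Tm.fn f [u, v]) ∧ x ∉ vars r ∧
        q = (Tm.fn f [Tm.fn f [u, v], Tm.var x], Tm.fn f [r, Tm.var x])}

/-- Signature with a binary AC symbol `+` and constants. -/
inductive Sig6 : Type
  | plus | a | b | c | d

/-- The AC axioms for `+`. -/
def AC6 : TRS Sig6 := ACax {Sig6.plus}

local notation:65 x:66 "⨤" y:66 => Tm.fn Sig6.plus [x, y]
local notation "𝗮" => Tm.fn Sig6.a []
local notation "𝗯" => Tm.fn Sig6.b []
local notation "𝗰" => Tm.fn Sig6.c []
local notation "𝗱" => Tm.fn Sig6.d []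

section General

variable {F : Type}

theorem subst_subst (σ τ : Nat → Tm F) (t : Tm F) :
    subst σ (subst τ t) = subst (fun n => subst σ (τ n)) t := by
  refine Tm.rec (motive_1 := fun t => subst σ (subst τ t) = subst (fun n => subst σ (τ n)) t)
    (motive_2 := fun ts =>
      substList σ (substList τ ts) = substList (fun n => subst σ (τ n)) ts)
    ?_ ?_ ?_ ?_ t <;> simp +contextual [subst, substList]

theorem substList_eq_map (σ : Nat → Tm F) (ts : List (Tm F)) :
    substList σ ts = ts.map (subst σ) := by
  induction ts <;> simp_all [substList]

/-- Non-variable subterms of a renamed term come from non-variable subterms. -/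
theorem subtermAt_rename (ρ : Nat ≃ Nat) {l : Tm F} {p : List Nat} {f : F} {ts : List (Tm F)}
    (h : subtermAt (rename ρ l) p = some (.fn f ts)) :
    ∃ ts', subtermAt l p = some (.fn f ts') ∧ rename ρ (.fn f ts') = .fn f ts := by
  induction p generalizing l with
  | nil =>
    cases l with
    | var n => simp [rename, subst, subtermAt] at h
    | fn g us =>
      simp only [rename, subst, subtermAt, Option.some.injEq, Tm.fn.injEq] at h
      obtain ⟨rfl, rfl⟩ := h
      exact ⟨us, by simp [subtermAt], by simp [rename, subst]⟩
  | cons i p ih =>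
    cases l with
    | var n => simp [rename, subst, subtermAt] at h
    | fn g us =>
      simp only [rename, subst, subtermAt, substList_eq_map, List.getElem?_map] at h ⊢
      cases hu : us[i]? with
      | none => simp [hu] at h
      | some u =>
        simp only [hu, Option.map_some] at h
        obtain ⟨ts', hs, hr⟩ := ih h
        simp only [rename, subst, substList_eq_map] at hr
        exact ⟨ts', hs, hr⟩

/-- Instances of two rules overlapping at a non-variable position of the second one, without
any requirement of most generality. -/
def Overlap (R₁ R₂ : TRS F) (t u : Tm F) : Prop :=
  ∃ q₁ ∈ R₁, ∃ q₂ ∈ R₂, ∃ τ₁ τ₂ p f ts, subtermAt q₂.1 p = some (.fn f ts) ∧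
    subst τ₁ q₁.1 = subst τ₂ (.fn f ts) ∧
    replaceAt (subst τ₂ q₂.1) p (subst τ₁ q₁.2) = some t ∧ u = subst τ₂ q₂.2

theorem CriticalPeak.overlap {R₁ R₂ : TRS F} {t s u : Tm F} {p : List Nat}
    (h : CriticalPeak R₁ R₂ t p s u) : Overlap R₁ R₂ t u := by
  obtain ⟨l₁, r₁, l₂, r₂, σ, ⟨q₁, hq₁, ρ₁, h₁, h₁'⟩, ⟨q₂, hq₂, ρ₂, h₂, h₂'⟩, -,
    ⟨f, ts, hs, hu, -⟩, -, rfl, ht, rfl⟩ := h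
  simp only at h₁ h₁' h₂ h₂'
  subst h₁ h₁' h₂ h₂'
  obtain ⟨ts', hs', hr⟩ := subtermAt_rename ρ₂ hs
  rw [Unifies, ← hr] at hu
  simp only [rename, subst_subst] at hu ht
  refine ⟨q₁, hq₁, q₂, hq₂, _, _, p, f, ts', hs', hu, ht, ?_⟩
  simp [rename, subst_subst]

theorem Rew.root {R : TRS F} {q : Tm F × Tm F} (h : q ∈ R) (σ : Nat → Tm F) :
    Rew R (subst σ q.1) (subst σ q.2) :=
  ⟨[], q.1, q.2, σ, h, by simp [subtermAt], by simp [replaceAt]⟩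

theorem Rew.context {R : TRS F} {u v : Tm F} (h : Rew R u v) (f : F) {ts : List (Tm F)} {i : Nat}
    (hi : ts[i]? = some u) : Rew R (.fn f ts) (.fn f (ts.set i v)) := by
  obtain ⟨p, l, r, σ, hR, hs, hr⟩ := h
  exact ⟨i :: p, l, r, σ, hR, by simp [subtermAt, hi, hs], by simp [replaceAt, hi, hr]⟩

theorem simE.context {B : TRS F} {u v : Tm F} (h : simE B u v) (f : F) {ts : List (Tm F)} {i : Nat}
    (hi : ts[i]? = some u) : simE B (.fn f ts) (.fn f (ts.set i v)) := by
  induction h generalizing ts with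
  | rel x y h => exact .rel _ _ (h.context f hi)
  | refl x =>
    have : ts.set i x = ts := by
      obtain ⟨hlt, rfl⟩ := List.getElem?_eq_some_iff.mp hi
      simp
    rw [this]
    exact .refl _
  | symm x y _ ih =>
    obtain ⟨hlt, rfl⟩ := List.getElem?_eq_some_iff.mp hi
    have := ih (ts := ts.set i x) (by simp [hlt])
    simp only [List.set_set, List.set_getElem_self] at this
    exact .symm _ _ this
  | trans x y z _ _ ih₁ ih₂ =>
    obtain ⟨hlt, -⟩ := List.getElem?_eq_some_iff.mp hi
    have := ih₂ (ts := ts.set i y) (by simp [hlt])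
    rw [List.set_set] at this
    exact .trans _ _ _ (ih₁ hi) this

theorem simE.replaceAt {B : TRS F} {u v s t : Tm F} {p : List Nat} (h : simE B u v)
    (hs : subtermAt s p = some u) (ht : replaceAt s p v = some t) : simE B s t := by
  induction p generalizing s t with
  | nil => simp_all [subtermAt, Tm.replaceAt]
  | cons i p ih =>
    cases s with
    | var n => simp [subtermAt] at hs
    | fn f ts =>
      simp only [subtermAt, Tm.replaceAt] at hs ht
      cases hu : ts[i]? with
      | none => simp [hu] at hs
      | some w =>
        simp only [hu, Option.map_eq_some_iff] at hs ht
        obtain ⟨w', hw', rfl⟩ := ht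
        exact (ih hs hw').context f hu

theorem subtermAt_subst (σ : Nat → Tm F) {l u : Tm F} {p : List Nat}
    (h : subtermAt l p = some u) : subtermAt (subst σ l) p = some (subst σ u) := by
  induction p generalizing l with
  | nil => simp_all [subtermAt]
  | cons i p ih =>
    cases l with
    | var n => simp [subtermAt] at h
    | fn g us =>
      simp only [subst, subtermAt, substList_eq_map, List.getElem?_map] at h ⊢
      cases hu : us[i]? with
      | none => simp [hu] at h
      | some w =>
        simp only [hu] at h
        simpa using ih h

/-- Rules whose instances are all contained in the equational theory of `B`. -/
def Sound (B : TRS F) : TRS F := {q | ∀ τ, simE B (subst τ q.1) (subst τ q.2)}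

/-- Overlaps between sound rules give equivalent terms. -/
theorem Overlap.simE_of_sound {B : TRS F} {t u : Tm F} (h : Overlap (Sound B) (Sound B) t u) :
    simE B t u := by
  obtain ⟨q₁, h₁, q₂, h₂, τ₁, τ₂, p, f, ts, hs, hu, ht, rfl⟩ := h
  have := subtermAt_subst τ₂ hs
  rw [← hu] at this
  exact .trans _ _ _ (.symm _ _ ((h₁ τ₁).replaceAt this ht)) (h₂ τ₂)

theorem sympm_subset_sound (B : TRS F) : sympm B ⊆ Sound B := by
  rintro q (hq | ⟨p, hp, rfl⟩) τ
  · exact .rel _ _ (Rew.root hq τ)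
  · exact .symm _ _ (.rel _ _ (Rew.root hp τ))

end General

/-- Rules that are instances of AC, moving terms towards `b + (a + a)` and `a + (b + a)`. -/
def acRules : TRS Sig6 :=
  {((𝗯 ⨤ 𝗮) ⨤ 𝗮, 𝗯 ⨤ (𝗮 ⨤ 𝗮)), ((𝗯 ⨤ 𝗮) ⨤ 𝗮, 𝗮 ⨤ (𝗯 ⨤ 𝗮)),
    (𝗮 ⨤ (𝗮 ⨤ 𝗯), 𝗮 ⨤ (𝗯 ⨤ 𝗮)), ((𝗮 ⨤ 𝗮) ⨤ 𝗯, 𝗯 ⨤ (𝗮 ⨤ 𝗮)),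
    ((𝗮 ⨤ 𝗯) ⨤ 𝗮, 𝗮 ⨤ (𝗯 ⨤ 𝗮)),
    (𝗯 ⨤ ((𝗮 ⨤ 𝗮) ⨤ .var 0), (𝗯 ⨤ (𝗮 ⨤ 𝗮)) ⨤ .var 0),
    ((.var 0 ⨤ 𝗯) ⨤ (𝗮 ⨤ 𝗮), .var 0 ⨤ (𝗯 ⨤ (𝗮 ⨤ 𝗮))),
    (𝗮 ⨤ ((𝗯 ⨤ 𝗮) ⨤ .var 0), (𝗮 ⨤ (𝗯 ⨤ 𝗮)) ⨤ .var 0),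
    ((.var 0 ⨤ 𝗮) ⨤ (𝗯 ⨤ 𝗮), .var 0 ⨤ (𝗮 ⨤ (𝗯 ⨤ 𝗮)))}

/-- The two rules leaving the AC equivalence class of their left-hand side. -/
def collapseRules : TRS Sig6 := {(𝗯 ⨤ (𝗮 ⨤ 𝗮), 𝗰), (𝗮 ⨤ (𝗯 ⨤ 𝗮), 𝗱)}

def witness : TRS Sig6 := acRules ∪ collapseRules

theorem AC6_assoc (x y z : Tm Sig6) : simE AC6 ((x ⨤ y) ⨤ z) (x ⨤ (y ⨤ z)) := by
  have := Rew.root (R := AC6) (q := ((.var 0 ⨤ .var 1) ⨤ .var 2, .var 0 ⨤ (.var 1 ⨤ .var 2)))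
    ⟨Sig6.plus, rfl, Or.inl rfl⟩ (fun n => match n with | 0 => x | 1 => y | _ => z)
  exact .rel _ _ (by simpa [subst, substList] using this)

theorem AC6_comm (x y : Tm Sig6) : simE AC6 (x ⨤ y) (y ⨤ x) := by
  have := Rew.root (R := AC6) (q := (.var 0 ⨤ .var 1, .var 1 ⨤ .var 0))
    ⟨Sig6.plus, rfl, Or.inr rfl⟩ (fun n => match n with | 0 => x | _ => y)
  exact .rel _ _ (by simpa [subst, substList] using this)

theorem AC6_congr_right (x : Tm Sig6) {y z : Tm Sig6} (h : simE AC6 y z) :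
    simE AC6 (x ⨤ y) (x ⨤ z) := h.context Sig6.plus (ts := [x, y]) (i := 1) rfl

theorem acRules_subset_sound : acRules ⊆ Sound AC6 := by
  intro q hq τ
  simp only [acRules, Set.mem_insert_iff, Set.mem_singleton_iff] at hq
  rcases hq with rfl | rfl | rfl | rfl | rfl | rfl | rfl | rfl | rfl <;>
    simp only [subst, substList]
  · exact AC6_assoc _ _ _
  · exact AC6_comm _ _
  · exact AC6_congr_right _ (AC6_comm _ _)
  · exact AC6_comm _ _
  · exact AC6_assoc _ _ _
  · exact .symm _ _ (AC6_assoc _ _ _)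
  · exact AC6_assoc _ _ _
  · exact .symm _ _ (AC6_assoc _ _ _)
  · exact AC6_assoc _ _ _

section Steps

open Relation

theorem witness_root {l r : Tm Sig6} (h : (l, r) ∈ witness) (x : Tm Sig6) :
    Rew witness (subst (fun _ => x) l) (subst (fun _ => x) r) := Rew.root h _

theorem witness_baa : Rew witness (𝗯 ⨤ (𝗮 ⨤ 𝗮)) 𝗰 := by
  simpa [subst, substList] using
    witness_root (l := 𝗯 ⨤ (𝗮 ⨤ 𝗮)) (r := 𝗰) (by simp [witness, collapseRules]) 𝗮

theorem witness_aba : Rew witness (𝗮 ⨤ (𝗯 ⨤ 𝗮)) 𝗱 := by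
  simpa [subst, substList] using
    witness_root (l := 𝗮 ⨤ (𝗯 ⨤ 𝗮)) (r := 𝗱) (by simp [witness, collapseRules]) 𝗮

theorem witness_ba_a_baa : Rew witness ((𝗯 ⨤ 𝗮) ⨤ 𝗮) (𝗯 ⨤ (𝗮 ⨤ 𝗮)) := by
  simpa [subst, substList] using
    witness_root (l := (𝗯 ⨤ 𝗮) ⨤ 𝗮) (r := 𝗯 ⨤ (𝗮 ⨤ 𝗮)) (by simp [witness, acRules]) 𝗮

theorem witness_ba_a_aba : Rew witness ((𝗯 ⨤ 𝗮) ⨤ 𝗮) (𝗮 ⨤ (𝗯 ⨤ 𝗮)) := by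
  simpa [subst, substList] using
    witness_root (l := (𝗯 ⨤ 𝗮) ⨤ 𝗮) (r := 𝗮 ⨤ (𝗯 ⨤ 𝗮)) (by simp [witness, acRules]) 𝗮

theorem witness_aab_aba : Rew witness (𝗮 ⨤ (𝗮 ⨤ 𝗯)) (𝗮 ⨤ (𝗯 ⨤ 𝗮)) := by
  simpa [subst, substList] using
    witness_root (l := 𝗮 ⨤ (𝗮 ⨤ 𝗯)) (r := 𝗮 ⨤ (𝗯 ⨤ 𝗮)) (by simp [witness, acRules]) 𝗮

theorem witness_aa_b_baa : Rew witness ((𝗮 ⨤ 𝗮) ⨤ 𝗯) (𝗯 ⨤ (𝗮 ⨤ 𝗮)) := by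
  simpa [subst, substList] using
    witness_root (l := (𝗮 ⨤ 𝗮) ⨤ 𝗯) (r := 𝗯 ⨤ (𝗮 ⨤ 𝗮)) (by simp [witness, acRules]) 𝗮

theorem witness_ab_a_aba : Rew witness ((𝗮 ⨤ 𝗯) ⨤ 𝗮) (𝗮 ⨤ (𝗯 ⨤ 𝗮)) := by
  simpa [subst, substList] using
    witness_root (l := (𝗮 ⨤ 𝗯) ⨤ 𝗮) (r := 𝗮 ⨤ (𝗯 ⨤ 𝗮)) (by simp [witness, acRules]) 𝗮

theorem witness_rotate_baa (x : Tm Sig6) :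
    Rew witness (𝗯 ⨤ ((𝗮 ⨤ 𝗮) ⨤ x)) ((𝗯 ⨤ (𝗮 ⨤ 𝗮)) ⨤ x) := by
  simpa [subst, substList] using
    witness_root (l := 𝗯 ⨤ ((𝗮 ⨤ 𝗮) ⨤ .var 0)) (r := (𝗯 ⨤ (𝗮 ⨤ 𝗮)) ⨤ .var 0)
      (by simp [witness, acRules]) x

theorem witness_rotate_xbaa (x : Tm Sig6) :
    Rew witness ((x ⨤ 𝗯) ⨤ (𝗮 ⨤ 𝗮)) (x ⨤ (𝗯 ⨤ (𝗮 ⨤ 𝗮))) := by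
  simpa [subst, substList] using
    witness_root (l := (.var 0 ⨤ 𝗯) ⨤ (𝗮 ⨤ 𝗮)) (r := .var 0 ⨤ (𝗯 ⨤ (𝗮 ⨤ 𝗮)))
      (by simp [witness, acRules]) x

theorem witness_rotate_aba (x : Tm Sig6) :
    Rew witness (𝗮 ⨤ ((𝗯 ⨤ 𝗮) ⨤ x)) ((𝗮 ⨤ (𝗯 ⨤ 𝗮)) ⨤ x) := by
  simpa [subst, substList] using
    witness_root (l := 𝗮 ⨤ ((𝗯 ⨤ 𝗮) ⨤ .var 0)) (r := (𝗮 ⨤ (𝗯 ⨤ 𝗮)) ⨤ .var 0)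
      (by simp [witness, acRules]) x

theorem witness_rotate_xaba (x : Tm Sig6) :
    Rew witness ((x ⨤ 𝗮) ⨤ (𝗯 ⨤ 𝗮)) (x ⨤ (𝗮 ⨤ (𝗯 ⨤ 𝗮))) := by
  simpa [subst, substList] using
    witness_root (l := (.var 0 ⨤ 𝗮) ⨤ (𝗯 ⨤ 𝗮)) (r := .var 0 ⨤ (𝗮 ⨤ (𝗯 ⨤ 𝗮)))
      (by simp [witness, acRules]) x

theorem Rew.plus_left {R : TRS Sig6} {x y : Tm Sig6} (h : Rew R x y) (z : Tm Sig6) :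
    Rew R (x ⨤ z) (y ⨤ z) := h.context Sig6.plus (ts := [x, z]) (i := 0) rfl

theorem Rew.plus_right {R : TRS Sig6} {x y : Tm Sig6} (h : Rew R x y) (z : Tm Sig6) :
    Rew R (z ⨤ x) (z ⨤ y) := h.context Sig6.plus (ts := [z, x]) (i := 1) rfl

theorem JoinMod.of_right {F : Type} {R B : TRS F} {s t : Tm F} (h : ReflTransGen (Rew R) t s) :
    JoinMod R B s t := ⟨s, s, .refl, .refl _, h⟩

theorem JoinMod.symm {F : Type} {R B : TRS F} {s t : Tm F} (h : JoinMod R B s t) :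
    JoinMod R B t s :=
  let ⟨u, v, hu, huv, hv⟩ := h
  ⟨v, u, hv, .symm _ _ huv, hu⟩

end Steps

/-- The rules of the witness together with both orientations of AC. -/
def allRules : TRS Sig6 := witness ∪ sympm AC6

theorem allRules_cases {q : Tm Sig6 × Tm Sig6} (h : q ∈ allRules) :
    q ∈ Sound AC6 ∨ q ∈ collapseRules := by
  rcases h with (h | h) | h
  · exact .inl (acRules_subset_sound h)
  · exact .inr h
  · exact .inl (sympm_subset_sound _ h)

theorem mem_sympm_AC6 {q : Tm Sig6 × Tm Sig6} (h : q ∈ sympm AC6) :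
    q = ((.var 0 ⨤ .var 1) ⨤ .var 2, .var 0 ⨤ (.var 1 ⨤ .var 2)) ∨
    q = (.var 0 ⨤ (.var 1 ⨤ .var 2), (.var 0 ⨤ .var 1) ⨤ .var 2) ∨
    q = (.var 0 ⨤ .var 1, .var 1 ⨤ .var 0) ∨ q = (.var 1 ⨤ .var 0, .var 0 ⨤ .var 1) := by
  rcases h with ⟨f, rfl, h⟩ | ⟨p, ⟨f, rfl, rfl | rfl⟩, rfl⟩
  · tauto
  · simp
  · simp

theorem mem_allRules {q : Tm Sig6 × Tm Sig6} (h : q ∈ allRules) :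
    q = ((𝗯 ⨤ 𝗮) ⨤ 𝗮, 𝗯 ⨤ (𝗮 ⨤ 𝗮)) ∨ q = ((𝗯 ⨤ 𝗮) ⨤ 𝗮, 𝗮 ⨤ (𝗯 ⨤ 𝗮)) ∨
    q = (𝗮 ⨤ (𝗮 ⨤ 𝗯), 𝗮 ⨤ (𝗯 ⨤ 𝗮)) ∨ q = ((𝗮 ⨤ 𝗮) ⨤ 𝗯, 𝗯 ⨤ (𝗮 ⨤ 𝗮)) ∨
    q = ((𝗮 ⨤ 𝗯) ⨤ 𝗮, 𝗮 ⨤ (𝗯 ⨤ 𝗮)) ∨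
    q = (𝗯 ⨤ ((𝗮 ⨤ 𝗮) ⨤ .var 0), (𝗯 ⨤ (𝗮 ⨤ 𝗮)) ⨤ .var 0) ∨
    q = ((.var 0 ⨤ 𝗯) ⨤ (𝗮 ⨤ 𝗮), .var 0 ⨤ (𝗯 ⨤ (𝗮 ⨤ 𝗮))) ∨
    q = (𝗮 ⨤ ((𝗯 ⨤ 𝗮) ⨤ .var 0), (𝗮 ⨤ (𝗯 ⨤ 𝗮)) ⨤ .var 0) ∨
    q = ((.var 0 ⨤ 𝗮) ⨤ (𝗯 ⨤ 𝗮), .var 0 ⨤ (𝗮 ⨤ (𝗯 ⨤ 𝗮))) ∨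
    q = (𝗯 ⨤ (𝗮 ⨤ 𝗮), 𝗰) ∨ q = (𝗮 ⨤ (𝗯 ⨤ 𝗮), 𝗱) ∨
    q = ((.var 0 ⨤ .var 1) ⨤ .var 2, .var 0 ⨤ (.var 1 ⨤ .var 2)) ∨
    q = (.var 0 ⨤ (.var 1 ⨤ .var 2), (.var 0 ⨤ .var 1) ⨤ .var 2) ∨
    q = (.var 0 ⨤ .var 1, .var 1 ⨤ .var 0) ∨ q = (.var 1 ⨤ .var 0, .var 0 ⨤ .var 1) := by
  rcases h with (h | h) | h
  · simp only [acRules, Set.mem_insert_iff, Set.mem_singleton_iff] at h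
    tauto
  · simp only [collapseRules, Set.mem_insert_iff, Set.mem_singleton_iff] at h
    tauto
  · have := mem_sympm_AC6 h
    tauto

theorem joinMod_c {t : Tm Sig6}
    (h : t = 𝗰 ∨ t = 𝗯 ⨤ (𝗮 ⨤ 𝗮) ∨ t = (𝗯 ⨤ 𝗮) ⨤ 𝗮 ∨ t = (𝗮 ⨤ 𝗮) ⨤ 𝗯) :
    JoinMod witness AC6 𝗰 t := by
  rcases h with rfl | rfl | rfl | rfl
  · exact .of_right .refl
  · exact .of_right (.single witness_baa)
  · exact .of_right (.head witness_ba_a_baa (.single witness_baa))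
  · exact .of_right (.head witness_aa_b_baa (.single witness_baa))

theorem joinMod_d {t : Tm Sig6}
    (h : t = 𝗱 ∨ t = 𝗮 ⨤ (𝗮 ⨤ 𝗯) ∨ t = (𝗯 ⨤ 𝗮) ⨤ 𝗮 ∨ t = (𝗮 ⨤ 𝗯) ⨤ 𝗮) :
    JoinMod witness AC6 𝗱 t := by
  rcases h with rfl | rfl | rfl | rfl
  · exact .of_right .refl
  · exact .of_right (.head witness_aab_aba (.single witness_aba))
  · exact .of_right (.head witness_ba_a_aba (.single witness_aba))
  · exact .of_right (.head witness_ab_a_aba (.single witness_aba))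

/-- The non-variable subterm of `t` at position `p` is instantiated to `g` by `τ`. -/
def MatchesAt (τ : Nat → Tm Sig6) (g t : Tm Sig6) (p : List Nat) : Prop :=
  ∃ f ts, subtermAt t p = some (.fn f ts) ∧ subst τ (.fn f ts) = g

theorem matchesAt_plus {τ : Nat → Tm Sig6} {g x y : Tm Sig6} {p : List Nat} :
    MatchesAt τ g (x ⨤ y) p ↔ (p = [] ∧ (subst τ x ⨤ subst τ y) = g) ∨
      (∃ p', p = 0 :: p' ∧ MatchesAt τ g x p') ∨ ∃ p', p = 1 :: p' ∧ MatchesAt τ g y p' := by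
  rcases p with _ | ⟨_ | _ | i, p⟩ <;> simp [MatchesAt, subtermAt, subst, substList]

theorem matchesAt_const {τ : Nat → Tm Sig6} {g : Tm Sig6} {f : Sig6} {p : List Nat} :
    MatchesAt τ g (.fn f []) p ↔ p = [] ∧ .fn f [] = g := by
  rcases p with _ | ⟨i, p⟩ <;> simp [MatchesAt, subtermAt, subst, substList]

theorem matchesAt_var {τ : Nat → Tm Sig6} {g : Tm Sig6} {n : Nat} {p : List Nat} :
    ¬ MatchesAt τ g (.var n) p := by
  rcases p with _ | ⟨i, p⟩ <;> simp [MatchesAt, subtermAt]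

theorem joinMod_of_inner {q₁ : Tm Sig6 × Tm Sig6} (h₁ : q₁ ∈ allRules)
    {q₂ : Tm Sig6 × Tm Sig6} (h₂ : q₂ ∈ collapseRules) {t u : Tm Sig6}
    (h : Overlap {q₁} {q₂} t u) : JoinMod witness AC6 u t := by
  obtain ⟨q₁, rfl, q₂, rfl, τ₁, τ₂, p, f, ts, hs, hu, ht, rfl⟩ := h
  have hm : MatchesAt τ₂ (subst τ₁ q₁.1) q₂.1 p := ⟨f, ts, hs, hu.symm⟩
  clear hs hu
  simp only [collapseRules, Set.mem_insert_iff, Set.mem_singleton_iff] at h₂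
  apply mem_allRules at h₁
  rcases h₂ with rfl | rfl <;>
  rcases h₁ with rfl | rfl | rfl | rfl | rfl | rfl | rfl | rfl | rfl | rfl | rfl | rfl | rfl |
    rfl | rfl <;>
  simp [subst, substList, matchesAt_plus, matchesAt_const] at hm
  all_goals try obtain hm | hm : _ ∨ _ := hm
  all_goals
    try simp only [@eq_comm _ _ (τ₁ _)] at hm
    simp [hm, subst, substList, replaceAt] at ht ⊢
    subst ht
  all_goals
    first
    | exact joinMod_c (by simp)
    | exact joinMod_d (by simp)

theorem joinMod_of_outer {q₁ : Tm Sig6 × Tm Sig6} (h₁ : q₁ ∈ collapseRules)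
    {q₂ : Tm Sig6 × Tm Sig6} (h₂ : q₂ ∈ allRules) {t u : Tm Sig6}
    (h : Overlap {q₁} {q₂} t u) : JoinMod witness AC6 t u := by
  obtain ⟨q₁, rfl, q₂, rfl, τ₁, τ₂, p, f, ts, hs, hu, ht, rfl⟩ := h
  have hm : MatchesAt τ₂ (subst τ₁ q₁.1) q₂.1 p := ⟨f, ts, hs, hu.symm⟩
  clear hs hu
  simp only [collapseRules, Set.mem_insert_iff, Set.mem_singleton_iff] at h₁
  apply mem_allRules at h₂
  rcases h₁ with rfl | rfl <;>
  rcases h₂ with rfl | rfl | rfl | rfl | rfl | rfl | rfl | rfl | rfl | rfl | rfl | rfl | rfl |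
    rfl | rfl <;>
  simp [subst, substList, matchesAt_plus, matchesAt_const, matchesAt_var] at hm
  all_goals try obtain hm | hm : _ ∨ _ := hm
  all_goals
    simp [hm, subst, substList, replaceAt] at ht ⊢
    subst ht
  all_goals
    first
    | exact joinMod_c (by simp)
    | exact joinMod_d (by simp)
    | exact .of_right (.head (witness_rotate_baa _) (.single (witness_baa.plus_left _)))
    | exact .of_right (.head (witness_rotate_xbaa _) (.single (witness_baa.plus_right _)))
    | exact .of_right (.head (witness_rotate_aba _) (.single (witness_aba.plus_left _)))
    | exact .of_right (.head (witness_rotate_xaba _) (.single (witness_aba.plus_right _)))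

theorem joinMod_of_overlap {t u : Tm Sig6} (h : Overlap allRules allRules t u) :
    JoinMod witness AC6 t u := by
  obtain ⟨q₁, h₁, q₂, h₂, h⟩ := h
  have h' : Overlap {q₁} {q₂} t u := ⟨q₁, rfl, q₂, rfl, h⟩
  rcases allRules_cases h₂ with h₂' | h₂'
  · rcases allRules_cases h₁ with h₁' | h₁'
    · exact ⟨t, u, .refl, Overlap.simE_of_sound ⟨q₁, h₁', q₂, h₂', h⟩, .refl⟩
    · exact joinMod_of_outer h₁' h₂ h'
  · exact (joinMod_of_inner h₁ h₂' h').symm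

open Classical in
/-- Contribution of a node to the termination measure: left-hand sides of collapse rules are
cheaper. -/
noncomputable def nodeWeight (t : Tm Sig6) : Nat :=
  if t = 𝗯 ⨤ (𝗮 ⨤ 𝗮) ∨ t = 𝗮 ⨤ (𝗯 ⨤ 𝗮) then 0 else 1

mutual
/-- The number of nodes minus the number of redexes of collapse rules. -/
noncomputable def weight : Tm Sig6 → Nat
  | .var _ => 1
  | .fn f ts => nodeWeight (.fn f ts) + weightList ts
noncomputable def weightList : List (Tm Sig6) → Nat
  | [] => 0
  | t :: ts => weight t + weightList ts
end

theorem weightList_set_lt {ts : List (Tm Sig6)} {i : Nat} {u v : Tm Sig6}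
    (hi : ts[i]? = some u) (h : weight v < weight u) :
    weightList (ts.set i v) < weightList ts := by
  induction ts generalizing i with
  | nil => simp at hi
  | cons t ts ih =>
    cases i with
    | zero => simp_all [weightList]
    | succ i => simpa [weightList] using ih (by simpa using hi)

theorem weight_root {q : Tm Sig6 × Tm Sig6} (h : q ∈ witness) (σ : Nat → Tm Sig6) :
    weight (subst σ q.2) < weight (subst σ q.1) := by
  simp only [witness, acRules, collapseRules, Set.mem_union, Set.mem_insert_iff,
    Set.mem_singleton_iff] at h
  rcases h with (rfl | rfl | rfl | rfl | rfl | rfl | rfl | rfl | rfl) | (rfl | rfl) <;>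
    simp [subst, substList, weight, weightList, nodeWeight] <;> omega

/-- Proper subterms of left-hand sides of collapse rules are not redexes. -/
theorem nodeWeight_of_redex {q : Tm Sig6 × Tm Sig6} (h : q ∈ witness) (σ : Nat → Tm Sig6)
    {f : Sig6} {ts : List (Tm Sig6)} {i : Nat} {p : List Nat}
    (hs : subtermAt (.fn f ts) (i :: p) = some (subst σ q.1)) : nodeWeight (.fn f ts) = 1 := by
  rw [nodeWeight, if_neg]
  simp only [witness, acRules, collapseRules, Set.mem_union, Set.mem_insert_iff,
    Set.mem_singleton_iff] at h
  rintro (h' | h') <;> rw [h'] at hs <;>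
  rcases i with _ | _ | i <;> rcases p with _ | ⟨_ | _ | j, _ | ⟨k, p⟩⟩ <;>
    simp [subtermAt] at hs <;>
  rcases h with (rfl | rfl | rfl | rfl | rfl | rfl | rfl | rfl | rfl) | (rfl | rfl) <;>
    simp [subst, substList] at hs

theorem weight_lt_of_rew {s t : Tm Sig6} (h : Rew witness s t) : weight t < weight s := by
  obtain ⟨p, l, r, σ, hR, hs, ht⟩ := h
  induction p generalizing s t with
  | nil =>
    simp only [subtermAt, replaceAt, Option.some.injEq] at hs ht
    subst hs ht
    exact weight_root hR σ
  | cons i p ih =>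
    cases s with
    | var n => simp [subtermAt] at hs
    | fn f ts =>
      have hw := nodeWeight_of_redex hR σ hs
      simp only [subtermAt, replaceAt] at hs ht
      cases hu : ts[i]? with
      | none => simp [hu] at hs
      | some w =>
        simp only [hu, Option.map_eq_some_iff] at hs ht
        obtain ⟨w', hw', rfl⟩ := ht
        have h₁ := weightList_set_lt hu (ih hs hw')
        have h₂ : nodeWeight (.fn f (ts.set i w')) ≤ 1 := by
          unfold nodeWeight; split <;> simp
        simp only [weight]
        omega

/-- Constants are irreducible if all left-hand sides are sums. -/
theorem not_rew_const {R : TRS Sig6} (hR : ∀ q ∈ R, ∃ ts, q.1 = .fn Sig6.plus ts) {f : Sig6}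
    (hf : f ≠ Sig6.plus) (t : Tm Sig6) : ¬ Rew R (.fn f []) t := by
  rintro ⟨_ | ⟨i, p⟩, l, r, σ, h, hs, -⟩
  · obtain ⟨ts, hl⟩ := hR _ h
    simp only at hl
    simp [subtermAt, hl, subst, hf] at hs
  · simp [subtermAt] at hs

theorem not_rew_to_const {R : TRS Sig6} (hR : ∀ q ∈ R, ∃ ts, q.2 = .fn Sig6.plus ts) {f : Sig6}
    (hf : f ≠ Sig6.plus) (s : Tm Sig6) : ¬ Rew R s (.fn f []) := by
  rintro ⟨_ | ⟨i, p⟩, l, r, σ, h, hs, ht⟩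
  · obtain ⟨ts, hl⟩ := hR _ h
    simp only at hl
    simp only [replaceAt, hl, subst, Option.some.injEq, Tm.fn.injEq] at ht
    exact hf ht.1.symm
  · cases s with
    | var n => simp [subtermAt] at hs
    | fn g ts =>
      simp only [subtermAt, replaceAt] at hs ht
      cases hu : ts[i]? with
      | none => simp [hu] at hs
      | some w =>
        simp only [hu, Option.map_eq_some_iff, Tm.fn.injEq, List.set_eq_nil_iff] at ht
        obtain ⟨_, -, -, rfl⟩ := ht
        simp at hu

theorem simE_AC6_const {f : Sig6} (hf : f ≠ Sig6.plus) {s t : Tm Sig6} (h : simE AC6 s t) :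
    s = .fn f [] ↔ t = .fn f [] := by
  induction h with
  | rel x y h =>
    constructor
    · rintro rfl
      refine absurd h (not_rew_const ?_ hf _)
      rintro q ⟨g, rfl, rfl | rfl⟩ <;> simp
    · rintro rfl
      refine absurd h (not_rew_to_const ?_ hf _)
      rintro q ⟨g, rfl, rfl | rfl⟩ <;> simp
  | refl => rfl
  | symm _ _ _ ih => exact ih.symm
  | trans _ _ _ _ _ ih₁ ih₂ => exact ih₁.trans ih₂

theorem witness_normal_const {f : Sig6} (hf : f ≠ Sig6.plus) {t : Tm Sig6}
    (h : Relation.ReflTransGen (Rew witness) (.fn f []) t) : t = .fn f [] := by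
  rcases h.cases_head with h | ⟨u, hu, -⟩
  · exact h.symm
  · refine absurd hu (not_rew_const (fun q hq => ?_) hf _)
    simp only [witness, acRules, collapseRules, Set.mem_union, Set.mem_insert_iff,
      Set.mem_singleton_iff] at hq
    rcases hq with (rfl | rfl | rfl | rfl | rfl | rfl | rfl | rfl | rfl) | (rfl | rfl) <;> simp

/-- There is a left-linear TRS which is terminating but not AC-terminating,
whose prime critical pairs (also with `AC^±`) are all joinable modulo AC,
yet which is not Church–Rosser modulo AC. -/
theorem stmt6 :
    ∃ R : TRS Sig6, IsTRS R ∧ LeftLinear R ∧ Terminating R ∧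
      ¬ TerminatingMod R AC6 ∧
      (∀ tu ∈ PCP R, JoinMod R AC6 tu.1 tu.2) ∧
      (∀ tu ∈ PCPpm R AC6, JoinMod R AC6 tu.1 tu.2) ∧
      ¬ ChurchRosserMod R AC6 := by
  refine ⟨witness, ?_, ?_, ?_, ?_, ?_, ?_, ?_⟩
  · intro q hq
    simp only [witness, acRules, collapseRules, Set.mem_union, Set.mem_insert_iff,
      Set.mem_singleton_iff] at hq
    rcases hq with (rfl | rfl | rfl | rfl | rfl | rfl | rfl | rfl | rfl) | (rfl | rfl) <;>
      simp [vars, varsList, varsListL]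
  · intro q hq
    simp only [witness, acRules, collapseRules, Set.mem_union, Set.mem_insert_iff,
      Set.mem_singleton_iff] at hq
    rcases hq with (rfl | rfl | rfl | rfl | rfl | rfl | rfl | rfl | rfl) | (rfl | rfl) <;>
      simp [Linear, varsList, varsListL]
  · exact Subrelation.wf (fun h => weight_lt_of_rew h) (measure weight).wf
  · intro h
    exact h.irrefl.irrefl ((𝗯 ⨤ 𝗮) ⨤ 𝗮)
      ⟨_, _, .refl _, witness_ba_a_baa, .symm _ _ (AC6_assoc _ _ _)⟩
  · rintro ⟨t, u⟩ ⟨p, s, h, -⟩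
    obtain ⟨q₁, h₁, q₂, h₂, h⟩ := h.overlap
    exact joinMod_of_overlap ⟨q₁, .inl h₁, q₂, .inl h₂, h⟩
  · rintro ⟨t, u⟩ ⟨p, s, h | h, -⟩
    · obtain ⟨q₁, h₁, q₂, h₂, h⟩ := h.overlap
      exact joinMod_of_overlap ⟨q₁, .inl h₁, q₂, .inr h₂, h⟩
    · obtain ⟨q₁, h₁, q₂, h₂, h⟩ := h.overlap
      exact joinMod_of_overlap ⟨q₁, .inr h₁, q₂, .inl h₂, h⟩
  · intro h
    have hconv : ConvMod witness AC6 𝗰 𝗱 :=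
      .head (.inr (.inl witness_baa)) <| .head (.inr (.inl witness_ba_a_baa)) <|
        .head (.inl witness_ba_a_aba) <| .single (.inl witness_aba)
    obtain ⟨u, v, hu, huv, hv⟩ := h _ _ hconv
    rw [witness_normal_const (by simp) hu, witness_normal_const (by simp) hv] at huv
    simpa using (simE_AC6_const (f := Sig6.c) (by simp) huv).mp rfl
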